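/- Let F_q be a finite field with q elements and let r ≥ 5 be a prime dividing q − 1. Then 2·κ(PSL_4(q), r) ≤ r² − 3r + 6. -/

import Mathlib

open Pointwise in
/-- `kappa J r` is the number of conjugacy classes of subgroups of order `r` in `J`. -/
noncomputable def kappa (J : Type*) [Group J] (r : ℕ) : ℕ :=
  Nat.card {c : Quotient (MulAction.orbitRel (ConjAct J) (Subgroup J)) //
    ∃ H : Subgroup J, Nat.card H = r ∧
      Quotient.mk (MulAction.orbitRel (ConjAct J) (Subgroup J)) H = c}

/-- An endomorphism whose `r`-th power is the identity is diagonalizable over a field containing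
a primitive `r`-th root of unity. -/
lemma span_eigenvectors_eq_top_of_pow_eq_one {F V : Type*} [Field F] [AddCommGroup V] [Module F V]
    {r : ℕ} (hr : (r : F) ≠ 0) {ζ : F} (hζ : IsPrimitiveRoot ζ r) (f : Module.End F V)
    (hf : f ^ r = 1) :
    Submodule.span F {v : V | ∃ k : ℕ, f v = ζ ^ k • v} = ⊤ := by
  have hr0 : 0 < r := Nat.pos_of_ne_zero (by rintro rfl; simp at hr)
  have hζ0 : ζ ≠ 0 := hζ.ne_zero hr0.ne'
  rw [eq_top_iff]
  rintro v -
  have hmem (k : ℕ) : ∑ i ∈ Finset.range r, (ζ⁻¹ ^ k) ^ i • (f ^ i) v ∈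
      Submodule.span F {v : V | ∃ k : ℕ, f v = ζ ^ k • v} := by
    refine Submodule.subset_span ⟨k, ?_⟩
    have hc : ζ ^ k * ζ⁻¹ ^ k = 1 := by rw [← mul_pow, mul_inv_cancel₀ hζ0, one_pow]
    have hcr : (ζ⁻¹ ^ k) ^ r = 1 := by
      rw [← pow_mul, mul_comm, pow_mul, inv_pow, hζ.pow_eq_one, inv_one, one_pow]
    have hshift := (Finset.sum_range_succ' (fun i ↦ (ζ⁻¹ ^ k) ^ i • (f ^ i) v) r).symm.trans
      (Finset.sum_range_succ _ r)
    simp only [pow_zero, hcr, hf] at hshift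
    conv_rhs => rw [← add_right_cancel hshift, Finset.smul_sum]
    rw [map_sum]
    refine Finset.sum_congr rfl fun i _ ↦ ?_
    rw [map_smul, smul_smul, pow_succ' (ζ⁻¹ ^ k), ← mul_assoc, hc, one_mul, pow_succ' f]
    rfl
  have hsum : ∑ k ∈ Finset.range r, ∑ i ∈ Finset.range r, (ζ⁻¹ ^ k) ^ i • (f ^ i) v
      = (r : F) • v := by
    rw [Finset.sum_comm]
    simp_rw [← Finset.sum_smul]
    rw [Finset.sum_eq_single_of_mem 0 (by simpa using hr0)]
    · simp
    intro i hi hi0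
    have hne : ζ⁻¹ ^ i ≠ 1 := hζ.inv.pow_ne_one_of_pos_of_lt hi0 (by simpa using hi)
    have hgeom := mul_geom_sum (ζ⁻¹ ^ i) r
    rw [← pow_mul, mul_comm i, pow_mul, hζ.inv.pow_eq_one, one_pow, sub_self] at hgeom
    have := (mul_eq_zero.mp hgeom).resolve_left (sub_ne_zero.mpr hne)
    simp_rw [← pow_mul, mul_comm _ i, pow_mul]
    rw [this, zero_smul]
  have := Submodule.smul_mem _ (r : F)⁻¹ (hsum ▸ Submodule.sum_mem _ fun k _ ↦ hmem k)
  rwa [smul_smul, inv_mul_cancel₀ hr, one_smul] at this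

open Matrix in
lemma Matrix.exists_mul_eq_mul_diagonal_of_pow_eq_one {F n : Type*} [Field F] [Fintype n]
    [DecidableEq n] {r : ℕ} (hr : (r : F) ≠ 0) {ζ : F} (hζ : IsPrimitiveRoot ζ r)
    (A : Matrix n n F) (hA : A ^ r = 1) :
    ∃ (P : Matrix n n F) (k : n → ℕ), P.det ≠ 0 ∧
      A * P = P * Matrix.diagonal fun i ↦ ζ ^ k i := by
  have hspan := span_eigenvectors_eq_top_of_pow_eq_one hr hζ (Matrix.toLin' A)
    (by rw [← Matrix.toLin'_pow, hA, Matrix.toLin'_one]; rfl)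
  let b₀ := Module.Basis.ofSpan hspan.ge
  let b := b₀.reindex (b₀.indexEquiv (Pi.basisFun F n))
  have hb (j : n) : ∃ k : ℕ, A *ᵥ b j = ζ ^ k • b j := by
    have : b j ∈ {v : n → F | ∃ k : ℕ, Matrix.toLin' A v = ζ ^ k • v} :=
      Module.Basis.ofSpan_subset hspan.ge (by
        rw [Module.Basis.reindex_apply]; exact Set.mem_range_self _)
    simpa using this
  choose k hk using hb
  refine ⟨(Pi.basisFun F n).toMatrix b, k, ?_, ?_⟩
  · have := Module.Basis.invertibleToMatrix (Pi.basisFun F n) b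
    exact (Matrix.isUnit_det_of_invertible _).ne_zero
  · ext i j
    have := congr_fun (hk j) i
    rw [Matrix.mul_diagonal]
    simpa [Matrix.mul_apply, Matrix.mulVec, dotProduct, Module.Basis.toMatrix_apply, mul_comm]
      using this

/-- A matrix of determinant one that is conjugate to a diagonal matrix under the general linear
group is conjugate to it under the special linear group. -/
lemma Matrix.SpecialLinearGroup.exists_conj_of_mul_eq_mul {F n : Type*} [Field F] [Fintype n]
    [DecidableEq n] [Nonempty n] {X Y : Matrix.SpecialLinearGroup n F} {P : Matrix n n F}
    {d : n → F} (hP : P.det ≠ 0) (hY : (Y : Matrix n n F) = Matrix.diagonal d)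
    (h : (X : Matrix n n F) * P = P * Y) :
    ∃ Q : Matrix.SpecialLinearGroup n F, X = Q * Y * Q⁻¹ := by
  let E : Matrix n n F := Matrix.diagonal (Function.update 1 (Classical.arbitrary n) P.det⁻¹)
  have hE : E.det = P.det⁻¹ := by
    rw [Matrix.det_diagonal, Finset.prod_update_of_mem (Finset.mem_univ _)]
    simp
  let Q : Matrix.SpecialLinearGroup n F :=
    ⟨P * E, by rw [Matrix.det_mul, hE, mul_inv_cancel₀ hP]⟩
  refine ⟨Q, ?_⟩
  rw [eq_mul_inv_iff_mul_eq]
  apply Subtype.ext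
  change (X : Matrix n n F) * (P * E) = P * E * Y
  rw [← mul_assoc, h, mul_assoc, mul_assoc, hY]
  congr 1
  simp only [E, Matrix.diagonal_mul_diagonal, mul_comm]

lemma exists_perm_of_map_univ_eq {ι α : Type*} [Fintype ι] {f g : ι → α}
    (h : (Finset.univ.val.map f : Multiset α) = Finset.univ.val.map g) :
    ∃ σ : Equiv.Perm ι, ∀ i, g (σ i) = f i := by
  classical
  have hcard (a : α) : Nonempty ({i // f i = a} ≃ {i // g i = a}) := by
    rw [← Fintype.card_eq, Fintype.card_subtype, Fintype.card_subtype]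
    have := congr_arg (Multiset.count a) h
    simpa [Multiset.count_map, eq_comm (a := a), Finset.card_def] using this
  exact ⟨Equiv.ofFiberEquiv fun a ↦ (hcard a).some, Equiv.ofFiberEquiv_map _⟩

open Pointwise in
lemma ConjAct.orbitRel_zpowers {G : Type*} [Group G] {x y g : G} (h : x = g * y * g⁻¹) :
    MulAction.orbitRel (ConjAct G) (Subgroup G) (Subgroup.zpowers x) (Subgroup.zpowers y) := by
  refine ⟨ConjAct.toConjAct g, ?_⟩
  subst h
  exact MonoidHom.map_zpowers _ _

lemma card_sym_three_sum_eq_mul {r : ℕ} [NeZero r] (h3 : IsUnit (3 : ZMod r)) (t : ZMod r) :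
    r * Nat.card {s : Sym (ZMod r) 3 // (s : Multiset (ZMod r)).sum = t} = (r + 2).choose 3 := by
  classical
  have hfib (u : ZMod r) : Nonempty ({s : Sym (ZMod r) 3 // (s : Multiset (ZMod r)).sum = u} ≃
      {s : Sym (ZMod r) 3 // (s : Multiset (ZMod r)).sum = t}) := by
    obtain ⟨x, hx⟩ := h3.dvd (a := t - u)
    refine ⟨(Sym.equivCongr (Equiv.addRight x)).subtypeEquiv fun s ↦ ?_⟩
    have : ((Sym.equivCongr (Equiv.addRight x) s : Sym (ZMod r) 3) : Multiset (ZMod r)).sum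
        = (s : Multiset (ZMod r)).sum + 3 * x := by
      simp [Sym.equivCongr, Sym.coe_map, Multiset.sum_map_add]
      ring
    rw [this, ← hx]
    constructor
    · rintro rfl; ring
    · intro h; linear_combination h
  have hcard : Nat.card (Sym (ZMod r) 3) = (r + 2).choose 3 := by
    rw [Nat.card_eq_fintype_card, Sym.card_sym_eq_choose, ZMod.card]
    rfl
  rw [← hcard, ← Nat.card_congr (Equiv.sigmaFiberEquiv
    fun s : Sym (ZMod r) 3 ↦ (s : Multiset (ZMod r)).sum), Nat.card_sigma,
    Finset.sum_congr rfl fun u _ ↦ Nat.card_congr (hfib u).some]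
  simp [ZMod.card]

lemma Subgroup.zpowers_pow_of_coprime {G : Type*} [Group G] {x : G} {m : ℕ}
    (h : (orderOf x).Coprime m) : Subgroup.zpowers (x ^ m) = Subgroup.zpowers x := by
  refine le_antisymm ?_ ?_
  · rw [Subgroup.zpowers_le]
    exact Subgroup.pow_mem _ (Subgroup.mem_zpowers x) m
  · rw [Subgroup.zpowers_le, mem_zpowers_pow_iff]
    exact h.symm

/-- A subgroup of `PSL_n(F)` of prime order `r` not dividing `n` is generated by the image of an
element of `SL_n(F)` of order dividing `r`. -/
lemma exists_zpowers_mk_eq_of_card_eq {F n : Type*} [Field F] [Fintype n]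
    [DecidableEq n] {r : ℕ} (hr : r.Prime) (hn : r.Coprime (Fintype.card n))
    (H : Subgroup (Matrix.ProjectiveSpecialLinearGroup n F)) (hH : Nat.card H = r) :
    ∃ A : Matrix.SpecialLinearGroup n F, A ^ r = 1 ∧
      Subgroup.zpowers (A : Matrix.ProjectiveSpecialLinearGroup n F) = H := by
  have := Fact.mk hr
  have := isCyclic_of_prime_card hH
  obtain ⟨h, rfl⟩ := (Subgroup.isCyclic_iff_exists_zpowers_eq_top H).mp this
  rw [Nat.card_zpowers] at hH
  obtain ⟨B, rfl⟩ := QuotientGroup.mk_surjective h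
  refine ⟨B ^ Fintype.card n, ?_, ?_⟩
  · have hB : B ^ r ∈ Subgroup.center (Matrix.SpecialLinearGroup n F) := by
      rw [← QuotientGroup.eq_one_iff, QuotientGroup.mk_pow, ← hH, pow_orderOf_eq_one]
    obtain ⟨c, hc, hcB⟩ := Matrix.SpecialLinearGroup.mem_center_iff.mp hB
    rw [← pow_mul, mul_comm, pow_mul]
    apply Subtype.ext
    rw [Matrix.SpecialLinearGroup.coe_pow, ← hcB, ← map_pow, hc, map_one]
    rfl
  · rw [QuotientGroup.mk_pow]
    exact Subgroup.zpowers_pow_of_coprime (hH ▸ hn)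

open Pointwise in
lemma exists_diagonal_orbitRel_zpowers {F : Type*} [Field F] {r : ℕ} (hr : r.Prime)
    (hr5 : 5 ≤ r) (hrF : (r : F) ≠ 0) {ζ : F} (hζ : IsPrimitiveRoot ζ r)
    (H : Subgroup (Matrix.ProjectiveSpecialLinearGroup (Fin 4) F)) (hH : Nat.card H = r) :
    ∃ (e : Fin 4 → ZMod r) (Y : Matrix.SpecialLinearGroup (Fin 4) F), e 0 = 1 ∧ ∑ i, e i = 0 ∧
      (Y : Matrix (Fin 4) (Fin 4) F) = Matrix.diagonal (fun i ↦ ζ ^ (e i).val) ∧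
      MulAction.orbitRel
        (ConjAct (Matrix.ProjectiveSpecialLinearGroup (Fin 4) F)) (Subgroup _) H
        (Subgroup.zpowers (Y : Matrix.ProjectiveSpecialLinearGroup (Fin 4) F)) := by
  have := Fact.mk hr
  have hcop : r.Coprime (Fintype.card (Fin 4)) := by
    refine (Nat.Prime.coprime_iff_not_dvd hr).mpr fun h ↦ ?_
    have := Nat.le_of_dvd (by simp) h
    rw [Fintype.card_fin] at this
    omega
  obtain ⟨A, hA, rfl⟩ := exists_zpowers_mk_eq_of_card_eq hr hcop H hH
  obtain ⟨P, k, hP, hAP⟩ := Matrix.exists_mul_eq_mul_diagonal_of_pow_eq_one hrF hζ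
    (A : Matrix (Fin 4) (Fin 4) F) (by rw [← Matrix.SpecialLinearGroup.coe_pow, hA]; rfl)
  obtain ⟨i₀, hi₀⟩ : ∃ i, (k i : ZMod r) ≠ 0 := by
    by_contra! hk
    have hone : (fun i ↦ ζ ^ k i) = fun _ ↦ 1 := funext fun i ↦
      (hζ.pow_eq_one_iff_dvd _).mpr ((ZMod.natCast_eq_zero_iff _ _).mp (hk i))
    rw [hone, Matrix.diagonal_one, mul_one] at hAP
    have hA1 : A = 1 := Subtype.ext <| (Matrix.isUnit_iff_isUnit_det P).mpr hP.isUnit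
      |>.mul_right_cancel (hAP.trans (one_mul P).symm)
    rw [hA1, Nat.card_zpowers, QuotientGroup.mk_one, orderOf_one] at hH
    omega
  let m := ((k i₀ : ZMod r)⁻¹).val
  have hm : (m : ZMod r) = (k i₀ : ZMod r)⁻¹ := ZMod.natCast_zmod_val _
  let σ : Equiv.Perm (Fin 4) := Equiv.swap 0 i₀
  let e : Fin 4 → ZMod r := fun i ↦ ((m * k (σ i) : ℕ) : ZMod r)
  have he (i : Fin 4) : ζ ^ (e i).val = (ζ ^ k (σ i)) ^ m := by
    rw [ZMod.val_natCast, ← pow_mul, mul_comm, ← pow_mod_orderOf, ← hζ.eq_orderOf]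
    rw [Nat.mod_mod]
    conv_rhs => rw [← pow_mod_orderOf, ← hζ.eq_orderOf]
  let D : Matrix (Fin 4) (Fin 4) F := Matrix.diagonal fun i ↦ ζ ^ (e i).val
  have hpow (j : ℕ) : (A : Matrix (Fin 4) (Fin 4) F) ^ j * P
      = P * Matrix.diagonal (fun i ↦ (ζ ^ k i) ^ j) := by
    induction j with
    | zero => simp
    | succ j ih =>
      rw [pow_succ', mul_assoc, ih, ← mul_assoc, hAP, mul_assoc, Matrix.diagonal_mul_diagonal]
      simp only [pow_succ']
  let P' := P.submatrix id σ
  have hP' : P'.det ≠ 0 := by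
    rw [Matrix.det_permute']
    exact mul_ne_zero ((Equiv.Perm.sign σ).isUnit.map (Int.castRingHom F)).ne_zero hP
  have hAP' : (A : Matrix (Fin 4) (Fin 4) F) ^ m * P' = P' * D := by
    ext i j
    have := congr_fun₂ (hpow m) i (σ j)
    rw [Matrix.mul_diagonal] at this ⊢
    rw [he]
    exact this
  have hD : D.det = 1 := by
    have := congr_arg Matrix.det hAP'
    rw [Matrix.det_mul, Matrix.det_mul, Matrix.det_pow, A.det_coe, one_pow, one_mul] at this
    exact (mul_eq_left₀ hP').mp this.symm
  refine ⟨e, ⟨D, hD⟩, ?_, ?_, rfl, ?_⟩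
  · simp only [e, σ, Equiv.swap_apply_left, Nat.cast_mul, hm]
    exact inv_mul_cancel₀ hi₀
  · rw [Matrix.det_diagonal, Finset.prod_pow_eq_pow_sum, hζ.pow_eq_one_iff_dvd,
      ← ZMod.natCast_eq_zero_iff] at hD
    simpa using hD
  · have hm0 : (orderOf (A : Matrix.ProjectiveSpecialLinearGroup (Fin 4) F)).Coprime m := by
      rw [Nat.card_zpowers] at hH
      rw [hH, Nat.Prime.coprime_iff_not_dvd hr, ← ZMod.natCast_eq_zero_iff, hm]
      exact inv_ne_zero hi₀
    obtain ⟨Q, hQ⟩ := Matrix.SpecialLinearGroup.exists_conj_of_mul_eq_mul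
      (X := A ^ m) (Y := ⟨D, hD⟩) hP' rfl (by rw [Matrix.SpecialLinearGroup.coe_pow]; exact hAP')
    rw [← Subgroup.zpowers_pow_of_coprime hm0]
    exact ConjAct.orbitRel_zpowers (g := (Q : Matrix.ProjectiveSpecialLinearGroup (Fin 4) F))
      (congr_arg QuotientGroup.mk hQ)

open Pointwise in
lemma orbitRel_zpowers_diagonal {F ι α : Type*} [Field F] [Fintype ι] [DecidableEq ι] [Nonempty ι]
    (χ : α → F) {e e' : ι → α}
    (h : (Finset.univ.val.map e : Multiset α) = Finset.univ.val.map e')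
    {X Y : Matrix.SpecialLinearGroup ι F}
    (hX : (X : Matrix ι ι F) = Matrix.diagonal (fun i ↦ χ (e i)))
    (hY : (Y : Matrix ι ι F) = Matrix.diagonal (fun i ↦ χ (e' i))) :
    MulAction.orbitRel (ConjAct (Matrix.ProjectiveSpecialLinearGroup ι F)) (Subgroup _)
      (Subgroup.zpowers (X : Matrix.ProjectiveSpecialLinearGroup ι F))
      (Subgroup.zpowers (Y : Matrix.ProjectiveSpecialLinearGroup ι F)) := by
  obtain ⟨σ, hσ⟩ := exists_perm_of_map_univ_eq h
  have hP : ((1 : Matrix ι ι F).submatrix σ id).det ≠ 0 := by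
    rw [Matrix.det_permute, Matrix.det_one, mul_one]
    exact ((Equiv.Perm.sign σ).isUnit.map (Int.castRingHom F)).ne_zero
  obtain ⟨Q, hQ⟩ := Matrix.SpecialLinearGroup.exists_conj_of_mul_eq_mul (X := X) (Y := Y) hP hY (by
    ext i j
    rw [hX, hY, Matrix.diagonal_mul, Matrix.mul_diagonal, ← hσ]
    by_cases hij : σ i = j
    · subst hij; exact mul_comm _ _
    · simp [hij])
  exact ConjAct.orbitRel_zpowers (g := (Q : Matrix.ProjectiveSpecialLinearGroup ι F))
    (congr_arg QuotientGroup.mk hQ)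

open Pointwise in
lemma kappa_projectiveSpecialLinearGroup_four_le {F : Type*} [Field F] {r : ℕ} (hr : r.Prime)
    (hr5 : 5 ≤ r) (hrF : (r : F) ≠ 0) {ζ : F} (hζ : IsPrimitiveRoot ζ r) :
    kappa (Matrix.ProjectiveSpecialLinearGroup (Fin 4) F) r ≤
      Nat.card {s : Sym (ZMod r) 3 // (s : Multiset (ZMod r)).sum = -1} := by
  have := Fact.mk hr
  have hrep (c : {c : Quotient (MulAction.orbitRel
      (ConjAct (Matrix.ProjectiveSpecialLinearGroup (Fin 4) F)) (Subgroup _)) //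
      ∃ H : Subgroup _, Nat.card H = r ∧ Quotient.mk (MulAction.orbitRel _ _) H = c}) :
      ∃ (s : {s : Sym (ZMod r) 3 // (s : Multiset (ZMod r)).sum = -1}) (e : Fin 4 → ZMod r)
        (Y : Matrix.SpecialLinearGroup (Fin 4) F),
        (Finset.univ.val.map e : Multiset (ZMod r)) = 1 ::ₘ (s.1 : Multiset (ZMod r)) ∧
        (Y : Matrix (Fin 4) (Fin 4) F) = Matrix.diagonal (fun i ↦ ζ ^ (e i).val) ∧
        c.1 = Quotient.mk (MulAction.orbitRel _ _)
          (Subgroup.zpowers (Y : Matrix.ProjectiveSpecialLinearGroup (Fin 4) F)) := by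
    obtain ⟨c, H, hH, rfl⟩ := c
    obtain ⟨e, Y, he0, hsum, hY, hrel⟩ := exists_diagonal_orbitRel_zpowers hr hr5 hrF hζ H hH
    refine ⟨⟨⟨Finset.univ.val.map fun i : Fin 3 ↦ e i.succ, by simp⟩, ?_⟩, e, Y, ?_, hY,
      Quotient.sound hrel⟩
    · rw [Fin.sum_univ_succ, he0] at hsum
      exact eq_neg_of_add_eq_zero_right hsum
    · have hcons : (Finset.univ.val.map e : Multiset (ZMod r))
          = e 0 ::ₘ Finset.univ.val.map fun i : Fin 3 ↦ e i.succ := by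
        rw [Fin.univ_val_map, Fin.univ_val_map, List.ofFn_succ, Multiset.cons_coe]
      rwa [he0] at hcons
  choose s e Y he hY hc using hrep
  refine Nat.card_le_card_of_injective s fun c c' h ↦ Subtype.ext ?_
  rw [hc c, hc c']
  exact Quotient.sound (orbitRel_zpowers_diagonal (fun a : ZMod r ↦ ζ ^ a.val)
    (by rw [he c, he c', h]) (hY c) (hY c'))

/-- Lemma 2.9(ii), linear case: if `r ≥ 5` is a prime dividing `q - 1`, then
`2·κ(PSL_4(q), r) ≤ r² - 3r + 6`. -/
theorem stmt_8 {q : ℕ} (r : ℕ) (F : Type*) [Field F] [Fintype F]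
    (hq : Fintype.card F = q) (hr : r.Prime) (hr5 : 5 ≤ r) (hdvd : r ∣ q - 1) :
    2 * kappa (Matrix.ProjectiveSpecialLinearGroup (Fin 4) F) r ≤ r ^ 2 - 3 * r + 6 := by
  have := Fact.mk hr
  subst hq
  have hcardu : Nat.card Fˣ = Fintype.card F - 1 := by
    rw [Nat.card_units, Nat.card_eq_fintype_card]
  obtain ⟨v, hv⟩ := exists_prime_orderOf_dvd_card' r (hcardu ▸ hdvd : r ∣ Nat.card Fˣ)
  have hζ : IsPrimitiveRoot (v : F) r :=
    IsPrimitiveRoot.coe_units_iff.mpr (hv ▸ IsPrimitiveRoot.orderOf v)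
  have hrF : (r : F) ≠ 0 := by
    intro h0
    have hdvd' : (r : F) ∣ ((Fintype.card F - 1 : ℕ) : F) := Nat.cast_dvd_cast hdvd
    rw [h0, Nat.cast_sub Fintype.card_pos, FiniteField.cast_card_eq_zero] at hdvd'
    simp at hdvd'
  have h3 : IsUnit (3 : ZMod r) := by
    refine Ne.isUnit fun h ↦ ?_
    have := Nat.le_of_dvd (by simp) ((ZMod.natCast_eq_zero_iff 3 r).mp (by exact_mod_cast h))
    omega
  have hκ := kappa_projectiveSpecialLinearGroup_four_le hr hr5 hrF hζ
  have hN := card_sym_three_sum_eq_mul h3 (-1)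
  generalize Nat.card {s : Sym (ZMod r) 3 // (s : Multiset (ZMod r)).sum = -1} = N at hκ hN
  have hchoose : 6 * (r + 2).choose 3 = (r + 2) * (r + 1) * r := by
    have := Nat.descFactorial_eq_factorial_mul_choose (r + 2) 3
    simp [Nat.descFactorial, Nat.factorial] at this
    linarith
  have h6 : 6 * N = (r + 2) * (r + 1) := by
    refine Nat.eq_of_mul_eq_mul_right hr.pos ?_
    rw [← hchoose, ← hN]
    ring
  obtain ⟨k, rfl⟩ := Nat.exists_eq_add_of_le hr5
  have hsub : (5 + k) ^ 2 - 3 * (5 + k) = (5 + k) * (2 + k) := by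
    rw [Nat.sub_eq_iff_eq_add (by nlinarith)]
    ring
  rw [hsub]
  nlinarith
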